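/- Let ε > 0. For every η > 0 there exists u₀ such that for all reals x > y ≥ 2, writing u = log x / log y, if u ≥ u₀ and u < y^{1-ε}, then x·u^{-u(1+η)} ≤ Ψ(x,y) ≤ x·u^{-u(1-η)}. (That is, Ψ(x,y) = x·u^{-u(1+o(1))} uniformly in the range u < y^{1-ε}, where the o(1) tends to 0 as u → ∞.) -/

import Mathlib

/-- `Psi x y` counts the positive integers `n ≤ x` that are `y`-smooth,
i.e. every prime divisor `p` of `n` satisfies `(p : ℝ) ≤ y`. -/
noncomputable def Psi (x y : ℝ) : ℕ :=
  {n : ℕ | 0 < n ∧ (n : ℝ) ≤ x ∧ ∀ p : ℕ, p.Prime → p ∣ n → (p : ℝ) ≤ y}.ncard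

/-- If `s` contains every prime factor of `n`, then `log n = ∑ p ∈ s, v_p(n) log p`. -/
theorem log_eq_sum_factorization_mul_log {n : ℕ} {s : Finset ℕ}
    (hs : ∀ p : ℕ, p.Prime → p ∣ n → p ∈ s) :
    Real.log n = ∑ p ∈ s, (n.factorization p : ℝ) * Real.log p := by
  rw [Real.log_nat_eq_sum_factorization, Finsupp.sum_of_support_subset]
  · intro p hp
    have := Nat.mem_primeFactors.1 (by simpa using hp)
    exact hs p this.1 this.2.1
  · simp

theorem log_factorial_eq_sum_primesLE (N : ℕ) :
    Real.log (N.factorial : ℝ) =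
      ∑ p ∈ N.primesLE, (N.factorial.factorization p : ℝ) * Real.log p :=
  log_eq_sum_factorization_mul_log fun _ hp h =>
    Nat.mem_primesLE.2 ⟨(hp.dvd_factorial).1 h, hp⟩

theorem sum_log_div_primesLE_le {N : ℕ} (hN : N ≠ 0) :
    ∑ p ∈ N.primesLE, Real.log p / p ≤ Real.log N + Real.log 4 := by
  have hN0 : (0 : ℝ) < N := by positivity
  have h1 : ∑ p ∈ N.primesLE, ((N : ℝ) / p - 1) * Real.log p ≤ Real.log (N.factorial : ℝ) := by
    rw [log_factorial_eq_sum_primesLE]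
    refine Finset.sum_le_sum fun p hp => ?_
    have hpp := Nat.prime_of_mem_primesLE hp
    refine mul_le_mul_of_nonneg_right ?_ (Real.log_natCast_nonneg p)
    have h2 : N / p ≤ N.factorial.factorization p := by
      rw [Nat.factorization_factorial hpp (Nat.lt_succ_self _)]
      have h3 : 1 ∈ Finset.Ico 1 (Nat.log p N).succ := by
        have := Nat.log_pos hpp.one_lt (Nat.le_of_mem_primesLE hp)
        exact Finset.mem_Ico.2 ⟨le_rfl, by omega⟩
      simpa using Finset.single_le_sum (f := fun i => N / p ^ i) (fun _ _ => Nat.zero_le _) h3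
    have h4 : (N : ℝ) / p < (N / p : ℕ) + 1 := by
      rw [← Nat.floor_div_eq_div (K := ℝ)]
      exact Nat.lt_floor_add_one _
    have h5 : ((N / p : ℕ) : ℝ) ≤ N.factorial.factorization p := by exact_mod_cast h2
    linarith
  have h6 : Real.log (N.factorial : ℝ) ≤ N * Real.log N := by
    rw [← Real.log_pow]
    exact Real.log_le_log (by positivity) (by exact_mod_cast N.factorial_le_pow)
  have h7 : ∑ p ∈ N.primesLE, ((N : ℝ) / p - 1) * Real.log p =
      N * ∑ p ∈ N.primesLE, Real.log p / p - Chebyshev.theta N := by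
    rw [Chebyshev.theta_eq_sum_primesLE_log, Finset.mul_sum, ← Finset.sum_sub_distrib]
    exact Finset.sum_congr rfl fun p _ => by ring
  have h8 := Chebyshev.theta_le_log4_mul_x hN0.le
  refine le_of_mul_le_mul_left ?_ hN0
  linarith

theorem exists_log_le_sum_log_div_primesLE :
    ∃ K : ℝ, 0 < K ∧ ∀ N : ℕ, N ≠ 0 →
      Real.log N - K ≤ ∑ p ∈ N.primesLE, Real.log p / p := by
  have hs : Summable fun n : ℕ => 4 * (n : ℝ) ^ (-(3 / 2) : ℝ) :=
    (Real.summable_nat_rpow.2 (by norm_num)).mul_left 4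
  set T := ∑' n : ℕ, 4 * (n : ℝ) ^ (-(3 / 2) : ℝ) with hT
  have hT0 : 0 ≤ T := tsum_nonneg fun n => by positivity
  refine ⟨T + 1, by positivity, fun N hN => ?_⟩
  have hN0 : (0 : ℝ) < N := by positivity
  have h1 : Real.log (N.factorial : ℝ) ≤
      ∑ p ∈ N.primesLE, (N * (Real.log p / p) + N * (4 * (p : ℝ) ^ (-(3 / 2) : ℝ))) := by
    rw [log_factorial_eq_sum_primesLE]
    refine Finset.sum_le_sum fun p hp => ?_
    have hpp := Nat.prime_of_mem_primesLE hp
    have hp2 : (2 : ℝ) ≤ p := by exact_mod_cast hpp.two_le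
    have h2 : (N.factorial.factorization p : ℝ) ≤ N / (p - 1) := by
      have h3 : (N.factorial.factorization p : ℝ) ≤ (N / (p - 1) : ℕ) := by
        exact_mod_cast Nat.factorization_factorial_le_div_pred hpp N
      refine h3.trans (Nat.cast_div_le.trans (le_of_eq ?_))
      rw [Nat.cast_sub hpp.one_le, Nat.cast_one]
    have h4 : Real.log p ≤ 2 * (p : ℝ) ^ (1 / 2 : ℝ) := by
      have := Real.log_le_rpow_div (x := (p : ℝ)) (by positivity) (ε := 1 / 2) (by norm_num)
      linarith
    have h5 : Real.log p / (p * (p - 1)) ≤ 4 * (p : ℝ) ^ (-(3 / 2) : ℝ) := by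
      rw [div_le_iff₀ (by nlinarith)]
      have h6 : (p : ℝ) ^ (1 / 2 : ℝ) = (p : ℝ) ^ (-(3 / 2) : ℝ) * (p * p) := by
        rw [← pow_two, ← Real.rpow_natCast, ← Real.rpow_add (by positivity)]
        norm_num
      have h7 : (0 : ℝ) < (p : ℝ) ^ (-(3 / 2) : ℝ) := by positivity
      rw [h6] at h4
      nlinarith [mul_nonneg h7.le (mul_nonneg (by linarith : (0 : ℝ) ≤ p)
        (by linarith : (0 : ℝ) ≤ p - 2))]
    calc (N.factorial.factorization p : ℝ) * Real.log p
        ≤ N / (p - 1) * Real.log p := mul_le_mul_of_nonneg_right h2 (Real.log_natCast_nonneg p)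
      _ = N * (Real.log p / p) + N * (Real.log p / (p * (p - 1))) := by
          have : (p : ℝ) - 1 ≠ 0 := by linarith
          field_simp
          ring
      _ ≤ _ := by gcongr
  rw [Finset.sum_add_distrib, ← Finset.mul_sum, ← Finset.mul_sum] at h1
  have h8 : ∑ p ∈ N.primesLE, 4 * (p : ℝ) ^ (-(3 / 2) : ℝ) ≤ T :=
    hs.sum_le_tsum _ fun n _ => by positivity
  have h9 := Stirling.le_log_factorial_stirling hN
  have h10 : 0 ≤ Real.log N / 2 := div_nonneg (Real.log_natCast_nonneg N) (by norm_num)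
  have h11 : 0 ≤ Real.log (2 * Real.pi) / 2 :=
    div_nonneg (Real.log_nonneg (by nlinarith [Real.pi_gt_three])) (by norm_num)
  have h12 := mul_le_mul_of_nonneg_left h8 hN0.le
  refine le_of_mul_le_mul_left ?_ hN0
  linarith

/-- A lower bound of the right order for `∑ 1 / p` over primes in `(y ^ (1 - δ), y]`. -/
theorem exists_half_le_sum_inv_primes {δ : ℝ} (hδ : 0 < δ) (hδ1 : δ < 1) :
    ∃ Y : ℝ, ∀ y : ℝ, 2 ≤ y → Y ≤ Real.log y →
      δ / 2 ≤ ∑ p ∈ (Nat.primesLE ⌊y⌋₊).filter (fun p : ℕ => y ^ (1 - δ) < (p : ℝ)),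
        1 / (p : ℝ) := by
  obtain ⟨K, hK0, hK⟩ := exists_log_le_sum_log_div_primesLE
  refine ⟨(K + Real.log 2 + Real.log 4) * (2 / δ), fun y hy hY => ?_⟩
  have hy0 : 0 < y := by linarith
  have hlogy : 0 < Real.log y := Real.log_pos (by linarith)
  set z := y ^ (1 - δ) with hz
  have hz1 : 1 ≤ z := Real.one_le_rpow (by linarith) (by linarith)
  have hzy : z ≤ y := by
    simpa using Real.rpow_le_rpow_of_exponent_le (by linarith : 1 ≤ y) (by linarith : 1 - δ ≤ 1)
  have hzf : ⌊z⌋₊ ≠ 0 := (Nat.floor_pos.2 hz1).ne'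
  have hyf : ⌊y⌋₊ ≠ 0 := (Nat.floor_pos.2 (by linarith)).ne'
  have h1 := hK _ hyf
  have h2 := sum_log_div_primesLE_le hzf
  have h3 : Real.log y - Real.log 2 ≤ Real.log ⌊y⌋₊ := by
    rw [← Real.log_div hy0.ne' (by norm_num)]
    refine Real.log_le_log (by positivity) ?_
    have := Nat.lt_floor_add_one y
    linarith
  have h4 : Real.log ⌊z⌋₊ ≤ (1 - δ) * Real.log y := by
    rw [← Real.log_rpow hy0]
    exact Real.log_le_log (by positivity) (Nat.floor_le (by linarith))
  have h5 : (Nat.primesLE ⌊y⌋₊).filter (fun p : ℕ => ¬ z < (p : ℝ)) = Nat.primesLE ⌊z⌋₊ := by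
    ext p
    simp only [Finset.mem_filter, Nat.mem_primesLE, not_lt, Nat.le_floor_iff hy0.le,
      Nat.le_floor_iff (by linarith : 0 ≤ z)]
    constructor
    · tauto
    · exact fun h => ⟨⟨h.1.trans hzy, h.2⟩, h.1⟩
  have h6 := Finset.sum_filter_add_sum_filter_not (Nat.primesLE ⌊y⌋₊)
    (fun p : ℕ => z < (p : ℝ)) (fun p => Real.log p / p)
  rw [h5] at h6
  have h7 : ∑ p ∈ (Nat.primesLE ⌊y⌋₊).filter (fun p : ℕ => z < (p : ℝ)), Real.log p / p ≤
      Real.log y * ∑ p ∈ (Nat.primesLE ⌊y⌋₊).filter (fun p : ℕ => z < (p : ℝ)), 1 / (p : ℝ) := by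
    rw [Finset.mul_sum]
    refine Finset.sum_le_sum fun p hp => ?_
    rw [Finset.mem_filter, Nat.mem_primesLE, Nat.le_floor_iff hy0.le] at hp
    have : (0 : ℝ) < p := by exact_mod_cast hp.1.2.pos
    rw [mul_one_div]
    gcongr
    exact hp.1.1
  have h8 : K + Real.log 2 + Real.log 4 ≤ δ / 2 * Real.log y := by
    have := mul_le_mul_of_nonneg_left hY (by positivity : 0 ≤ δ / 2)
    calc _ = δ / 2 * ((K + Real.log 2 + Real.log 4) * (2 / δ)) := by field_simp
      _ ≤ _ := this
  refine le_of_mul_le_mul_left ?_ hlogy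
  linarith

theorem sum_log_div_primesLE_floor_le {y : ℝ} (hy : 2 ≤ y) :
    ∑ p ∈ Nat.primesLE ⌊y⌋₊, Real.log p / p ≤ 3 * Real.log y := by
  have hyf : ⌊y⌋₊ ≠ 0 := (Nat.floor_pos.2 (by linarith)).ne'
  have h1 : Real.log ⌊y⌋₊ ≤ Real.log y :=
    Real.log_le_log (by positivity) (Nat.floor_le (by linarith))
  have h2 : Real.log 4 = 2 * Real.log 2 := by
    rw [← Real.log_rpow (by norm_num)]; norm_num
  have h3 : Real.log 2 ≤ Real.log y := Real.log_le_log (by norm_num) hy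
  linarith [sum_log_div_primesLE_le hyf]

open Classical in
/-- The `y`-smooth positive integers up to `x`, as a finset. -/
noncomputable def smoothUpTo (x y : ℝ) : Finset ℕ :=
  (Finset.Icc 1 ⌊x⌋₊).filter fun n => ∀ p : ℕ, p.Prime → p ∣ n → (p : ℝ) ≤ y

theorem mem_smoothUpTo {x y : ℝ} {n : ℕ} :
    n ∈ smoothUpTo x y ↔
      0 < n ∧ (n : ℝ) ≤ x ∧ ∀ p : ℕ, p.Prime → p ∣ n → (p : ℝ) ≤ y := by
  simp only [smoothUpTo, Finset.mem_filter, Finset.mem_Icc, and_assoc]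
  refine and_congr_right fun hn => and_congr_left fun _ => ?_
  exact Nat.le_floor_iff' (by omega)

theorem Psi_eq_card (x y : ℝ) : Psi x y = (smoothUpTo x y).card := by
  rw [Psi, ← Set.ncard_coe_finset]
  congr 1
  ext n
  simp [mem_smoothUpTo]

theorem Psi_le_self {x : ℝ} (hx : 0 ≤ x) (y : ℝ) : (Psi x y : ℝ) ≤ x := by
  have h : smoothUpTo x y ⊆ Finset.Icc 1 ⌊x⌋₊ := fun n hn => by
    obtain ⟨hn0, hnx, -⟩ := mem_smoothUpTo.1 hn
    exact Finset.mem_Icc.2 ⟨hn0, Nat.le_floor hnx⟩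
  rw [Psi_eq_card]
  refine le_trans ?_ (Nat.floor_le hx)
  exact_mod_cast (Finset.card_le_card h).trans (by simp)

theorem half_le_Psi {x y : ℝ} (hx : 1 ≤ x) (hxy : x ≤ y) : x / 2 ≤ (Psi x y : ℝ) := by
  have h : smoothUpTo x y = Finset.Icc 1 ⌊x⌋₊ := by
    ext n
    rw [mem_smoothUpTo, Finset.mem_Icc]
    constructor
    · exact fun h => ⟨h.1, Nat.le_floor h.2.1⟩
    · intro h
      have hn : (n : ℝ) ≤ x := (Nat.le_floor_iff (by linarith)).1 h.2
      refine ⟨h.1, hn, fun p _ hpn => ?_⟩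
      have : (p : ℝ) ≤ n := by exact_mod_cast Nat.le_of_dvd h.1 hpn
      linarith
  rw [Psi_eq_card, h, Nat.card_Icc, Nat.add_sub_cancel]
  have h1 := Nat.lt_floor_add_one x
  have h2 : (1 : ℝ) ≤ ⌊x⌋₊ := by exact_mod_cast Nat.floor_pos.2 hx
  linarith

/-- Multiplication by a prime `p ≤ y` identifies the smooth numbers up to `x / p` with the
multiples of `p` among the smooth numbers up to `x`. -/
theorem sum_smoothUpTo_filter_dvd {x y : ℝ} {p : ℕ} (hp : p.Prime) (hpy : (p : ℝ) ≤ y)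
    (f : ℕ → ℝ) :
    ∑ n ∈ (smoothUpTo x y).filter (p ∣ ·), f n = ∑ m ∈ smoothUpTo (x / p) y, f (p * m) := by
  have hp0 : (0 : ℝ) < p := by exact_mod_cast hp.pos
  symm
  refine Finset.sum_bij (fun m _ => p * m) ?_ ?_ ?_ (fun _ _ => rfl)
  · intro m hm
    rw [mem_smoothUpTo] at hm
    rw [Finset.mem_filter, mem_smoothUpTo]
    refine ⟨⟨Nat.mul_pos hp.pos hm.1, ?_, fun q hq hqd => ?_⟩, dvd_mul_right _ _⟩
    · have := hm.2.1
      rw [le_div_iff₀ hp0] at this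
      push_cast
      linarith
    · rcases (hq.dvd_mul).1 hqd with h | h
      · rwa [(Nat.prime_dvd_prime_iff_eq hq hp).1 h]
      · exact hm.2.2 q hq h
  · intro a _ b _ h
    exact Nat.eq_of_mul_eq_mul_left hp.pos h
  · intro n hn
    rw [Finset.mem_filter, mem_smoothUpTo] at hn
    obtain ⟨⟨h0, hx, hs⟩, m, rfl⟩ := hn
    refine ⟨m, mem_smoothUpTo.2 ⟨Nat.pos_of_mul_pos_left h0, ?_, fun q hq hqm => ?_⟩, rfl⟩
    · rw [le_div_iff₀ hp0]
      push_cast at hx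
      linarith
    · exact hs q hq (hqm.mul_left p)

theorem card_smoothUpTo_filter_dvd {x y : ℝ} {p : ℕ} (hp : p.Prime) (hpy : (p : ℝ) ≤ y) :
    (((smoothUpTo x y).filter (p ∣ ·)).card : ℝ) = Psi (x / p) y := by
  have := sum_smoothUpTo_filter_dvd (x := x) hp hpy (fun _ => 1)
  simpa [Psi_eq_card] using this

theorem sum_factorization_smoothUpTo {x y : ℝ} {p : ℕ} (hp : p.Prime) (hpy : (p : ℝ) ≤ y) :
    ∑ n ∈ smoothUpTo x y, (n.factorization p : ℝ) =
      Psi (x / p) y + ∑ n ∈ smoothUpTo (x / p) y, (n.factorization p : ℝ) := by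
  have h1 : ∑ n ∈ smoothUpTo x y, (n.factorization p : ℝ) =
      ∑ n ∈ (smoothUpTo x y).filter (p ∣ ·), (n.factorization p : ℝ) := by
    rw [Finset.sum_filter_of_ne]
    intro n _ h
    by_contra hd
    exact h (by simp [Nat.factorization_eq_zero_of_not_dvd hd])
  rw [h1, sum_smoothUpTo_filter_dvd hp hpy, Psi_eq_card, Finset.card_eq_sum_ones, Nat.cast_sum,
    ← Finset.sum_add_distrib]
  refine Finset.sum_congr rfl fun m hm => ?_
  rw [Nat.factorization_mul hp.ne_zero (mem_smoothUpTo.1 hm).1.ne']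
  simp [hp.factorization_self]

/-- Iterating `Ψ(X, y) log X ≥ ∑ Ψ(X / p, y) log z` over primes `p ∈ (z, y]`. -/
theorem mul_pow_le_Psi {y z U q : ℝ} (hz : 1 < z) (hU : 0 < U) (hq0 : 0 ≤ q) (hq1 : q ≤ 1)
    (hq : U * q ≤ ∑ p ∈ (Nat.primesLE ⌊y⌋₊).filter (fun p : ℕ => z < (p : ℝ)), 1 / (p : ℝ))
    (hy0 : 0 ≤ y) (k : ℕ) :
    ∀ X : ℝ, 1 ≤ X → X ≤ y * z ^ k → Real.log X ≤ U * Real.log z →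
      X / 2 * q ^ k ≤ Psi X y := by
  induction k with
  | zero =>
    intro X hX1 hX _
    simpa using half_le_Psi hX1 (by simpa using hX)
  | succ k ih =>
    intro X hX1 hX hlog
    rcases le_or_gt X y with hXy | hXy
    · refine le_trans ?_ (half_le_Psi hX1 hXy)
      exact mul_le_of_le_one_right (by linarith) (pow_le_one₀ hq0 hq1)
    set Q := (Nat.primesLE ⌊y⌋₊).filter (fun p : ℕ => z < (p : ℝ)) with hQ
    have hQm : ∀ p ∈ Q, p.Prime ∧ (p : ℝ) ≤ y ∧ z < (p : ℝ) := by
      intro p hp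
      rw [hQ, Finset.mem_filter, Nat.mem_primesLE, Nat.le_floor_iff hy0] at hp
      exact ⟨hp.1.2, hp.1.1, hp.2⟩
    have hlogz : 0 < Real.log z := Real.log_pos hz
    have hcount : ∀ n ∈ smoothUpTo X y, ((Q.filter (· ∣ n)).card : ℝ) ≤ U := by
      intro n hn
      obtain ⟨hn0, hnX, -⟩ := mem_smoothUpTo.1 hn
      have h1 : ∏ p ∈ Q.filter (· ∣ n), p ≤ n :=
        Nat.le_of_dvd hn0 <| Finset.prod_primes_dvd n
          (fun p hp => (hQm p (Finset.mem_filter.1 hp).1).1.prime)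
          (fun p hp => (Finset.mem_filter.1 hp).2)
      have h2 : z ^ (Q.filter (· ∣ n)).card ≤ X := by
        refine le_trans ?_ (le_trans (Nat.cast_le.2 h1) hnX)
        rw [Nat.cast_prod, ← Finset.prod_const]
        exact Finset.prod_le_prod (fun _ _ => by linarith)
          fun p hp => (hQm p (Finset.mem_filter.1 hp).1).2.2.le
      have h3 := Real.log_le_log (by positivity) h2
      rw [Real.log_pow] at h3
      exact le_of_mul_le_mul_right (h3.trans hlog) hlogz
    have h1 : ∑ p ∈ Q, (Psi (X / p) y : ℝ) ≤ Psi X y * U := by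
      calc ∑ p ∈ Q, (Psi (X / p) y : ℝ)
          = ∑ p ∈ Q, ∑ n ∈ smoothUpTo X y, if p ∣ n then (1 : ℝ) else 0 := by
            refine Finset.sum_congr rfl fun p hp => ?_
            rw [← card_smoothUpTo_filter_dvd (hQm p hp).1 (hQm p hp).2.1, Finset.sum_boole]
        _ = ∑ n ∈ smoothUpTo X y, ((Q.filter (· ∣ n)).card : ℝ) := by
            rw [Finset.sum_comm]
            exact Finset.sum_congr rfl fun n _ => by rw [Finset.sum_boole]
        _ ≤ ∑ n ∈ smoothUpTo X y, U := Finset.sum_le_sum hcount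
        _ = Psi X y * U := by rw [Psi_eq_card]; simp
    have h2 : ∀ p ∈ Q, X / 2 * q ^ k * (1 / (p : ℝ)) ≤ Psi (X / p) y := by
      intro p hp
      obtain ⟨hpp, hpy, hzp⟩ := hQm p hp
      have hp0 : (0 : ℝ) < p := by exact_mod_cast hpp.pos
      have hp1 : (1 : ℝ) ≤ p := by exact_mod_cast hpp.one_le
      have h3 : 1 ≤ X / p := (one_le_div hp0).2 (by linarith)
      have h4 : X / p ≤ y * z ^ k := by
        rw [div_le_iff₀ hp0]
        calc X ≤ y * z ^ (k + 1) := hX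
          _ = y * z ^ k * z := by ring
          _ ≤ y * z ^ k * p := by gcongr
      have h5 : Real.log (X / p) ≤ Real.log X :=
        Real.log_le_log (by positivity) (div_le_self (by linarith) hp1)
      calc X / 2 * q ^ k * (1 / (p : ℝ)) = X / p / 2 * q ^ k := by ring
        _ ≤ _ := ih _ h3 h4 (h5.trans hlog)
    have h6 := Finset.sum_le_sum h2
    rw [← Finset.mul_sum] at h6
    have h7 : X / 2 * q ^ k * (U * q) ≤ _ := mul_le_mul_of_nonneg_left hq (by positivity)
    refine le_of_mul_le_mul_right ?_ hU
    calc X / 2 * q ^ (k + 1) * U = X / 2 * q ^ k * (U * q) := by ring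
      _ ≤ _ := h7.trans (h6.trans h1)

/-- A Rankin-type bound without the Euler product: an induction on the size of `X` based on
`∑ log n = ∑ log p ∑ v_p(n)`. -/
theorem Psi_le_mul_rpow {y σ L : ℝ} (hy : 0 ≤ y) (hσ0 : 0 < σ) (hσ1 : σ ≤ 1) (hL : 0 < L)
    (hS : ∑ p ∈ Nat.primesLE ⌊y⌋₊, Real.log p / ((p : ℝ) ^ σ - 1) ≤ (1 - 2 ^ (-σ)) * L)
    {X : ℝ} (hX : 0 < X) :
    (Psi X y : ℝ) ≤ (2 * Real.exp L) ^ (1 - σ) * X ^ σ := by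
  set A := (2 * Real.exp L) ^ (1 - σ) with hA
  have hA0 : 0 < A := by positivity
  have hsmall : ∀ X : ℝ, 0 < X → X ≤ 2 * Real.exp L → (Psi X y : ℝ) ≤ A * X ^ σ := by
    intro X hX0 hX
    refine (Psi_le_self hX0.le y).trans ?_
    calc X = X ^ (1 - σ) * X ^ σ := by rw [← Real.rpow_add hX0]; simp
      _ ≤ A * X ^ σ := by
        gcongr
        exact Real.rpow_le_rpow hX0.le hX (by linarith)
  have hP : ∀ p ∈ Nat.primesLE ⌊y⌋₊, p.Prime ∧ (p : ℝ) ≤ y ∧ 0 < (p : ℝ) ^ σ - 1 := by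
    intro p hp
    rw [Nat.mem_primesLE, Nat.le_floor_iff hy] at hp
    refine ⟨hp.2, hp.1, sub_pos.2 (Real.one_lt_rpow ?_ hσ0)⟩
    exact_mod_cast hp.2.one_lt
  have key : ∀ k : ℕ, ∀ X : ℝ, 0 < X → X ≤ 2 ^ k → (Psi X y : ℝ) ≤ A * X ^ σ ∧
      ∀ p ∈ Nat.primesLE ⌊y⌋₊, ∑ n ∈ smoothUpTo X y, (n.factorization p : ℝ) ≤
        A * X ^ σ * (1 / ((p : ℝ) ^ σ - 1)) := by
    intro k
    induction k with
    | zero =>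
      intro X hX0 hX1
      rw [pow_zero] at hX1
      refine ⟨hsmall X hX0 (by linarith [Real.add_one_le_exp L]), fun p hp => ?_⟩
      rw [Finset.sum_eq_zero]
      · have := (hP p hp).2.2
        positivity
      · intro n hn
        obtain ⟨hn0, hnX, -⟩ := mem_smoothUpTo.1 hn
        have : n ≤ 1 := by exact_mod_cast hnX.trans hX1
        obtain rfl : n = 1 := by omega
        simp
    | succ k ih =>
      intro X hX0 hXk
      have hT : ∀ p ∈ Nat.primesLE ⌊y⌋₊, ∑ n ∈ smoothUpTo X y, (n.factorization p : ℝ) ≤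
          A * X ^ σ * (1 / ((p : ℝ) ^ σ - 1)) := by
        intro p hp
        obtain ⟨hpp, hpy, hpσ⟩ := hP p hp
        have hp2 : (2 : ℝ) ≤ p := by exact_mod_cast hpp.two_le
        have hp0 : (0 : ℝ) < p := by linarith
        have h1 : X / p ≤ 2 ^ k := by
          rw [div_le_iff₀ hp0]
          calc X ≤ 2 ^ k * 2 := by rw [← pow_succ]; exact hXk
            _ ≤ 2 ^ k * p := by gcongr
        obtain ⟨h2, h3⟩ := ih (X / p) (by positivity) h1
        rw [sum_factorization_smoothUpTo hpp hpy]
        refine (add_le_add h2 (h3 p hp)).trans (le_of_eq ?_)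
        rw [Real.div_rpow hX0.le hp0.le]
        have h4 : (p : ℝ) ^ σ ≠ 0 := by positivity
        have h5 := hpσ.ne'
        field_simp
        ring
      refine ⟨?_, hT⟩
      rcases le_or_gt X (2 * Real.exp L) with hXL | hXL
      · exact hsmall X hX0 hXL
      have hlog : L < Real.log (X / 2) := by
        rw [Real.lt_log_iff_exp_lt (by positivity)]
        linarith
      have h1 : (Psi (X / 2) y : ℝ) ≤ A * X ^ σ * 2 ^ (-σ) := by
        refine (ih (X / 2) (by positivity) ?_).1.trans (le_of_eq ?_)
        · rw [pow_succ] at hXk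
          linarith
        · rw [Real.div_rpow hX0.le (by norm_num), Real.rpow_neg (by norm_num)]
          ring
      have h2 : ∑ n ∈ smoothUpTo X y, Real.log n ≤ A * X ^ σ * ((1 - 2 ^ (-σ)) * L) := by
        calc ∑ n ∈ smoothUpTo X y, Real.log n
            = ∑ n ∈ smoothUpTo X y, ∑ p ∈ Nat.primesLE ⌊y⌋₊,
                (n.factorization p : ℝ) * Real.log p := by
              refine Finset.sum_congr rfl fun n hn => log_eq_sum_factorization_mul_log ?_
              intro p hp hpn
              rw [Nat.mem_primesLE, Nat.le_floor_iff hy]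
              exact ⟨(mem_smoothUpTo.1 hn).2.2 p hp hpn, hp⟩
          _ = ∑ p ∈ Nat.primesLE ⌊y⌋₊,
                (∑ n ∈ smoothUpTo X y, (n.factorization p : ℝ)) * Real.log p := by
              rw [Finset.sum_comm]
              exact Finset.sum_congr rfl fun p _ => by rw [Finset.sum_mul]
          _ ≤ ∑ p ∈ Nat.primesLE ⌊y⌋₊,
                A * X ^ σ * (1 / ((p : ℝ) ^ σ - 1)) * Real.log p :=
              Finset.sum_le_sum fun p hp =>
                mul_le_mul_of_nonneg_right (hT p hp) (Real.log_natCast_nonneg p)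
          _ = A * X ^ σ * ∑ p ∈ Nat.primesLE ⌊y⌋₊, Real.log p / ((p : ℝ) ^ σ - 1) := by
              rw [Finset.mul_sum]
              exact Finset.sum_congr rfl fun p _ => by ring
          _ ≤ _ := by gcongr
      have h3 := Finset.sum_filter_add_sum_filter_not (smoothUpTo X y)
        (fun n : ℕ => (n : ℝ) ≤ X / 2) (fun _ => (1 : ℝ))
      have h4 : ∑ n ∈ (smoothUpTo X y).filter (fun n : ℕ => (n : ℝ) ≤ X / 2), (1 : ℝ) ≤
          Psi (X / 2) y := by
        rw [Psi_eq_card, Finset.sum_const, nsmul_eq_mul, mul_one]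
        refine Nat.cast_le.2 (Finset.card_le_card fun n hn => ?_)
        rw [Finset.mem_filter, mem_smoothUpTo] at hn
        exact mem_smoothUpTo.2 ⟨hn.1.1, hn.2, hn.1.2.2⟩
      have h5 : L * ∑ n ∈ (smoothUpTo X y).filter (fun n : ℕ => ¬ (n : ℝ) ≤ X / 2), (1 : ℝ) ≤
          ∑ n ∈ smoothUpTo X y, Real.log n := by
        rw [Finset.mul_sum]
        refine le_trans (Finset.sum_le_sum fun n hn => ?_)
          (Finset.sum_le_sum_of_subset_of_nonneg (Finset.filter_subset _ _)
            fun n _ _ => Real.log_natCast_nonneg n)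
        rw [Finset.mem_filter, not_le] at hn
        have := Real.log_le_log (by positivity) hn.2.le
        linarith
      have h6 : ∑ n ∈ (smoothUpTo X y).filter (fun n : ℕ => ¬ (n : ℝ) ≤ X / 2), (1 : ℝ) ≤
          A * X ^ σ * (1 - 2 ^ (-σ)) := by
        refine le_of_mul_le_mul_left ?_ hL
        linarith
      have h7 : (Psi X y : ℝ) = ∑ n ∈ smoothUpTo X y, (1 : ℝ) := by simp [Psi_eq_card]
      linarith
  obtain ⟨k, hk⟩ := pow_unbounded_of_one_lt X (one_lt_two)
  exact (key k X hX hk.le).1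

theorem eventually_log_two_add_mul_le {η : ℝ} (hη : 0 < η) (κ : ℝ) :
    ∀ᶠ u : ℝ in Filter.atTop,
      Real.log 2 + ((1 + η / 2) * u + 1) * (Real.log u + κ) ≤ (1 + η) * (u * Real.log u) := by
  filter_upwards [Filter.eventually_ge_atTop 1, Filter.eventually_ge_atTop (4 / η),
    Real.tendsto_log_atTop.eventually_ge_atTop (4 / η * (|κ| * (2 + η / 2) + 1))]
    with u hu1 hu2 hu3
  have hlog : 0 ≤ Real.log u := Real.log_nonneg hu1
  have h1 : Real.log 2 ≤ 1 := by linarith [Real.log_two_lt_d9]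
  have h2 : Real.log u ≤ η / 4 * (u * Real.log u) := by
    have : 1 ≤ η / 4 * u := by
      rw [div_le_iff₀ hη] at hu2
      linarith
    nlinarith
  have h3 : (|κ| * (2 + η / 2) + 1) * u ≤ η / 4 * (u * Real.log u) := by
    have : |κ| * (2 + η / 2) + 1 ≤ η / 4 * Real.log u := by
      calc _ = η / 4 * (4 / η * (|κ| * (2 + η / 2) + 1)) := by field_simp
        _ ≤ _ := by gcongr
    nlinarith
  have h4 : ((1 + η / 2) * u + 1) * κ ≤ |κ| * (2 + η / 2) * u := by
    calc ((1 + η / 2) * u + 1) * κ ≤ ((1 + η / 2) * u + 1) * |κ| := by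
          gcongr
          exact le_abs_self κ
      _ ≤ ((1 + η / 2) * u + u) * |κ| := by gcongr
      _ = _ := by ring
  nlinarith

theorem eventually_log_two_add_rpow_mul_le {θ : ℝ} (hθ : 0 < θ) (C : ℝ) :
    ∀ᶠ u : ℝ in Filter.atTop,
      Real.log 2 + C * (u ^ (1 - θ) * Real.log u) ≤ θ * (u * Real.log u) := by
  have ht : Filter.Tendsto (fun u : ℝ => C * u ^ (-θ)) Filter.atTop (nhds 0) := by
    simpa using (tendsto_rpow_neg_atTop hθ).const_mul C
  filter_upwards [Filter.eventually_ge_atTop 1, Filter.eventually_ge_atTop (2 / θ),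
    Real.tendsto_log_atTop.eventually_ge_atTop 1,
    ht.eventually_le_const (by positivity : 0 < θ / 2)] with u hu1 hu2 hu3 hu4
  have h1 : Real.log 2 ≤ 1 := by linarith [Real.log_two_lt_d9]
  have h2 : 1 ≤ θ / 2 * u := by
    rw [div_le_iff₀ hθ] at hu2
    linarith
  have h3 : u ^ (1 - θ) = u * u ^ (-θ) := by
    rw [sub_eq_add_neg, Real.rpow_add (by linarith), Real.rpow_one]
  have h4 : 1 ≤ θ / 2 * (u * Real.log u) := by nlinarith
  have h5 : C * u ^ (-θ) * (u * Real.log u) ≤ θ / 2 * (u * Real.log u) := by gcongr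
  rw [h3]
  linarith

theorem exists_mul_rpow_le_Psi {η : ℝ} (hη : 0 < η) :
    ∃ u₀ : ℝ, ∀ x y : ℝ, 2 ≤ y → y < x → u₀ ≤ Real.log x / Real.log y →
      Real.log x / Real.log y < y →
      x * (Real.log x / Real.log y) ^ (-(Real.log x / Real.log y) * (1 + η)) ≤ Psi x y := by
  set β := 1 + η / 2 with hβ
  have hβ1 : 1 < β := by linarith
  have hβ0 : 0 < β := by linarith
  set δ := 1 - β⁻¹ with hδ
  have hδ0 : 0 < δ := sub_pos.2 (inv_lt_one_of_one_lt₀ hβ1)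
  have hδ1 : δ < 1 := by linarith [inv_pos.2 hβ0]
  obtain ⟨Y, hY⟩ := exists_half_le_sum_inv_primes hδ0 hδ1
  obtain ⟨u₁, hu₁⟩ := Filter.eventually_atTop.1
    (eventually_log_two_add_mul_le hη (Real.log (β / (δ / 2))))
  refine ⟨max u₁ (max 1 (Real.exp Y)), fun x y hy hyx hu huy => ?_⟩
  set u := Real.log x / Real.log y with hudef
  simp only [max_le_iff] at hu
  obtain ⟨hu1, hu2, hu3⟩ := hu
  have hy0 : 0 < y := by linarith
  have hx0 : 0 < x := by linarith
  have hu0 : 0 < u := by linarith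
  have hly : 0 < Real.log y := Real.log_pos (by linarith)
  have hlx : Real.log x = u * Real.log y := by rw [hudef]; field_simp
  have hYy : Y ≤ Real.log y := (Real.le_log_iff_exp_le hy0).2 (by linarith)
  have hsum := hY y hy hYy
  have hδβ : 1 - δ = β⁻¹ := by rw [hδ]; ring
  set z := y ^ (1 - δ) with hz
  have hlz : Real.log z = β⁻¹ * Real.log y := by rw [hz, Real.log_rpow hy0, hδβ]
  have hz1 : 1 < z := Real.one_lt_rpow (by linarith) (by linarith)
  set q := δ / 2 / (β * u) with hq
  have hq0 : 0 < q := by positivity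
  have hβu : 1 ≤ β * u := by nlinarith
  have hq1 : q ≤ 1 := by
    rw [hq, div_le_one (by positivity)]
    linarith
  set k := ⌈β * u⌉₊ with hk
  have hk1 : β * u ≤ k := Nat.le_ceil _
  have hk2 : (k : ℝ) ≤ β * u + 1 := (Nat.ceil_lt_add_one (by positivity)).le
  have hxz : Real.log x ≤ β * u * Real.log z := by
    rw [hlx, hlz]
    apply le_of_eq
    field_simp
  have hxk : x ≤ y * z ^ k := by
    have h1 : x ≤ z ^ k := by
      rw [← Real.log_le_log_iff hx0 (by positivity), Real.log_pow]
      exact hxz.trans (mul_le_mul_of_nonneg_right hk1 (Real.log_pos hz1).le)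
    have : 0 < z ^ k := by positivity
    nlinarith
  have hmain := mul_pow_le_Psi (y := y) (U := β * u) (q := q) hz1 (by positivity) hq0.le hq1
    (by rw [hq]; field_simp; field_simp at hsum; exact hsum) hy0.le k x (by linarith) hxk hxz
  refine le_trans ?_ hmain
  rw [← Real.log_le_log_iff (by positivity) (by positivity), Real.log_mul hx0.ne' (by positivity),
    Real.log_rpow hu0, Real.log_mul (by positivity) (by positivity),
    Real.log_div hx0.ne' (by norm_num), Real.log_pow]
  have hlq : Real.log q = -(Real.log u + Real.log (β / (δ / 2))) := by
    rw [← Real.log_mul hu0.ne' (by positivity), ← Real.log_inv]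
    congr 1
    rw [hq]
    field_simp
  have hlq0 : Real.log q ≤ 0 := Real.log_nonpos hq0.le hq1
  have h2 := hu₁ u hu1
  have h3 : (β * u + 1) * Real.log q ≤ k * Real.log q := mul_le_mul_of_nonpos_right hk2 hlq0
  rw [hlq] at h3 ⊢
  rw [← hβ] at h2
  linarith

theorem exists_Psi_le_mul_rpow {ε η : ℝ} (hε : 0 < ε) (hε1 : ε < 1) (hη : 0 < η) :
    ∃ u₀ : ℝ, ∀ x y : ℝ, 2 ≤ y → y < x → u₀ ≤ Real.log x / Real.log y →
      Real.log x / Real.log y < y ^ (1 - ε) →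
      Psi x y ≤ x * (Real.log x / Real.log y) ^ (-(Real.log x / Real.log y) * (1 - η)) := by
  set θ := min η 1 / 2 with hθ
  have hθ0 : 0 < θ := by positivity
  have hθη : 2 * θ ≤ η := by linarith [min_le_left η 1]
  have hθ1 : θ < 1 := by linarith [min_le_right η 1]
  set c : ℝ := 1 - 2 ^ (-ε) with hc
  have hc0 : 0 < c := sub_pos.2 (Real.rpow_lt_one_of_one_lt_of_neg (by norm_num) (by linarith))
  obtain ⟨u₁, hu₁⟩ := Filter.eventually_atTop.1
    (eventually_log_two_add_rpow_mul_le hθ0 (3 / c ^ 2))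
  refine ⟨max u₁ 1, fun x y hy hyx hu huy => ?_⟩
  set u := Real.log x / Real.log y with hudef
  obtain ⟨hu1, hu2⟩ := max_le_iff.1 hu
  have hy0 : 0 < y := by linarith
  have hx0 : 0 < x := by linarith
  have hu0 : 0 < u := by linarith
  have hly : 0 < Real.log y := Real.log_pos (by linarith)
  have hlu : 0 ≤ Real.log u := Real.log_nonneg hu2
  have hlx : Real.log x = u * Real.log y := by rw [hudef]; field_simp
  have hluy : Real.log u ≤ (1 - ε) * Real.log y := by
    rw [← Real.log_rpow hy0]
    exact Real.log_le_log hu0 huy.le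
  obtain ⟨τ, hτ⟩ : ∃ τ : ℝ, τ = (1 - θ) * Real.log u / Real.log y := ⟨_, rfl⟩
  have hτy : τ * Real.log y = (1 - θ) * Real.log u := by rw [hτ]; field_simp
  have hτ0 : 0 ≤ τ := by
    rw [hτ]
    exact div_nonneg (mul_nonneg (by linarith) hlu) hly.le
  have hτε : τ ≤ 1 - ε := by
    refine le_of_mul_le_mul_right ?_ hly
    rw [hτy]
    nlinarith
  have hyτ : y ^ τ = u ^ (1 - θ) := by
    rw [Real.rpow_def_of_pos hy0, Real.rpow_def_of_pos hu0, mul_comm, hτy, mul_comm]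
  set V := u ^ (1 - θ) with hV
  have hV0 : 0 < V := by positivity
  have hL0 : 0 < 3 * Real.log y * V / c ^ 2 := by positivity
  have hcσ : c ≤ 1 - 2 ^ (-(1 - τ)) := by
    have : (2 : ℝ) ^ (-(1 - τ)) ≤ 2 ^ (-ε) :=
      Real.rpow_le_rpow_of_exponent_le (by norm_num) (by linarith)
    linarith
  have hS : ∑ p ∈ Nat.primesLE ⌊y⌋₊, Real.log p / ((p : ℝ) ^ (1 - τ) - 1) ≤
      (1 - 2 ^ (-(1 - τ))) * (3 * Real.log y * V / c ^ 2) := by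
    calc ∑ p ∈ Nat.primesLE ⌊y⌋₊, Real.log p / ((p : ℝ) ^ (1 - τ) - 1)
        ≤ ∑ p ∈ Nat.primesLE ⌊y⌋₊, V / c * (Real.log p / p) := by
          refine Finset.sum_le_sum fun p hp => ?_
          rw [Nat.mem_primesLE, Nat.le_floor_iff hy0.le] at hp
          have hp2 : (2 : ℝ) ≤ p := by exact_mod_cast hp.2.two_le
          have hp0 : (0 : ℝ) < p := by linarith
          have h1 : (p : ℝ) ≤ (p : ℝ) ^ (1 - τ) * V := by
            calc (p : ℝ) = (p : ℝ) ^ (1 - τ) * (p : ℝ) ^ τ := by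
                  rw [← Real.rpow_add hp0]; simp
              _ ≤ (p : ℝ) ^ (1 - τ) * V := by
                  rw [← hyτ]
                  gcongr
                  exact hp.1
          have h2 : 1 ≤ (p : ℝ) ^ (1 - τ) * 2 ^ (-ε) := by
            calc (1 : ℝ) = 2 ^ ε * 2 ^ (-ε) := by rw [← Real.rpow_add (by norm_num)]; simp
              _ ≤ (p : ℝ) ^ (1 - τ) * 2 ^ (-ε) := by
                  gcongr
                  exact (Real.rpow_le_rpow_of_exponent_le (by norm_num) (by linarith)).trans
                    (Real.rpow_le_rpow (by norm_num) hp2 (by linarith))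
          have h3 : c * (p : ℝ) ^ (1 - τ) ≤ (p : ℝ) ^ (1 - τ) - 1 := by
            rw [hc]
            linarith
          have h4 : c * p / V ≤ (p : ℝ) ^ (1 - τ) - 1 := by
            refine le_trans ?_ h3
            rw [div_le_iff₀ hV0, mul_assoc]
            gcongr
          calc Real.log p / ((p : ℝ) ^ (1 - τ) - 1) ≤ Real.log p / (c * p / V) :=
                div_le_div_of_nonneg_left (Real.log_natCast_nonneg p) (by positivity) h4
            _ = V / c * (Real.log p / p) := by field_simp
      _ = V / c * ∑ p ∈ Nat.primesLE ⌊y⌋₊, Real.log p / p := by rw [Finset.mul_sum]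
      _ ≤ V / c * (3 * Real.log y) := by
          gcongr
          exact sum_log_div_primesLE_floor_le hy
      _ = c * (3 * Real.log y * V / c ^ 2) := by field_simp
      _ ≤ _ := by gcongr
  refine (Psi_le_mul_rpow hy0.le (by linarith : 0 < 1 - τ) (by linarith) hL0 hS hx0).trans ?_
  rw [← Real.log_le_log_iff (by positivity) (by positivity),
    Real.log_mul (by positivity) (by positivity), Real.log_rpow (by positivity),
    Real.log_rpow hx0, Real.log_mul (by norm_num) (by positivity), Real.log_exp,
    Real.log_mul hx0.ne' (by positivity), Real.log_rpow hu0, hlx]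
  have h1 : τ * (3 * Real.log y * V / c ^ 2) = (1 - θ) * (3 / c ^ 2 * (V * Real.log u)) := by
    calc _ = τ * Real.log y * (3 * V / c ^ 2) := by ring
      _ = _ := by rw [hτy]; ring
  have h2 : τ * (u * Real.log y) = (1 - θ) * (u * Real.log u) := by
    calc _ = u * (τ * Real.log y) := by ring
      _ = _ := by rw [hτy]; ring
  have h3 := hu₁ u hu1
  have h4 : (1 - θ) * (3 / c ^ 2 * (V * Real.log u)) ≤ 3 / c ^ 2 * (V * Real.log u) :=
    mul_le_of_le_one_left (by positivity) (by linarith)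
  have h5 : τ * Real.log 2 ≤ Real.log 2 :=
    mul_le_of_le_one_left (Real.log_nonneg (by norm_num)) (by linarith)
  have h6 : 2 * θ * (u * Real.log u) ≤ η * (u * Real.log u) := by gcongr
  rw [← hV] at h3
  linarith

theorem stmt1 (ε : ℝ) (hε : 0 < ε) :
    ∀ η : ℝ, 0 < η → ∃ u₀ : ℝ, ∀ x y : ℝ, 2 ≤ y → y < x →
      u₀ ≤ Real.log x / Real.log y →
      Real.log x / Real.log y < y ^ (1 - ε) →
      x * (Real.log x / Real.log y) ^ (-(Real.log x / Real.log y) * (1 + η)) ≤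
          (Psi x y : ℝ) ∧
        (Psi x y : ℝ) ≤
          x * (Real.log x / Real.log y) ^ (-(Real.log x / Real.log y) * (1 - η)) := by
  intro η hη
  obtain ⟨u₁, h₁⟩ := exists_mul_rpow_le_Psi hη
  rcases lt_or_ge ε 1 with hε1 | hε1
  · obtain ⟨u₂, h₂⟩ := exists_Psi_le_mul_rpow hε hε1 hη
    refine ⟨max u₁ u₂, fun x y hy hyx hu huy => ?_⟩
    obtain ⟨hu1, hu2⟩ := max_le_iff.1 hu
    have hyε : y ^ (1 - ε) ≤ y := by
      simpa using Real.rpow_le_rpow_of_exponent_le (by linarith : 1 ≤ y)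
        (by linarith : 1 - ε ≤ 1)
    exact ⟨h₁ x y hy hyx hu1 (huy.trans_le hyε), h₂ x y hy hyx hu2 huy⟩
  · refine ⟨1, fun x y hy hyx hu huy => ?_⟩
    have := Real.rpow_le_one_of_one_le_of_nonpos (by linarith : 1 ≤ y)
      (by linarith : 1 - ε ≤ 0)
    linarith
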